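/- There exist two non-isomorphic trees T and T' on 8 vertices (i.e., connected acyclic simple graphs on 8 vertices) such that the largest eigenvalue of the Laplacian matrix of T equals the largest eigenvalue of the Laplacian matrix of T', while the largest eigenvalue of the adjacency matrix of T is different from the largest eigenvalue of the adjacency matrix of T'. -/

import Mathlib

open Classical in
/-- Adjacency matrix of a simple graph, with real entries. -/
noncomputable def adjMat {V : Type*} [Fintype V] (G : SimpleGraph V) : Matrix V V ℝ :=
  fun i j => if G.Adj i j then 1 else 0

/-- Degree of a vertex, as a real number (row sum of the adjacency matrix). -/
noncomputable def degRe {V : Type*} [Fintype V] (G : SimpleGraph V) (v : V) : ℝ :=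
  ∑ j, adjMat G v j

/-- Laplacian matrix `L(G) = D(G) - A(G)`. -/
noncomputable def lapMat {V : Type*} [Fintype V] [DecidableEq V] (G : SimpleGraph V) :
    Matrix V V ℝ :=
  Matrix.diagonal (degRe G) - adjMat G

/-- Largest eigenvalue of the adjacency matrix (which is real symmetric, so its spectrum is a
nonempty finite set of reals). -/
noncomputable def lam1 {V : Type*} [Fintype V] [DecidableEq V] (G : SimpleGraph V) : ℝ :=
  sSup (spectrum ℝ (adjMat G))

/-- Largest eigenvalue of the Laplacian matrix. -/
noncomputable def q1 {V : Type*} [Fintype V] [DecidableEq V] (G : SimpleGraph V) : ℝ :=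
  sSup (spectrum ℝ (lapMat G))

/-- Sum of squared vertex degrees (the second degree power / zeroth Randić index). -/
noncomputable def F2 {V : Type*} [Fintype V] (G : SimpleGraph V) : ℝ :=
  ∑ v, (degRe G v) ^ 2

/-- The graph distance measure `d_I(G,H) = 1 - exp(-((I(G)-I(H))/σ)^2)`, as a function of the
parameter `σ` and the two invariant values `x = I(G)` and `y = I(H)`. -/
noncomputable def dMeasure (σ x y : ℝ) : ℝ :=
  1 - Real.exp (-(((x - y) / σ) ^ 2))

/-- An eigenvalue of a real matrix `M` is at most `r` if `|M| x ≤ r x` for some positive `x`. -/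
theorem le_of_mem_spectrum_of_abs_mulVec_le {V : Type*} [Fintype V] [DecidableEq V]
    {M : Matrix V V ℝ} {x : V → ℝ} {r : ℝ} (hx : ∀ i, 0 < x i)
    (h : ∀ i, ∑ j, |M i j| * x j ≤ r * x i) {μ : ℝ} (hμ : μ ∈ spectrum ℝ M) : μ ≤ r := by
  rw [← Matrix.spectrum_toLin', ← Module.End.hasEigenvalue_iff_mem_spectrum] at hμ
  obtain ⟨v, hv⟩ := hμ.exists_hasEigenvector
  have hMv : M.mulVec v = μ • v := by simpa using hv.apply_eq_smul
  obtain ⟨k, hk⟩ := Function.ne_iff.mp hv.2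
  have : Nonempty V := ⟨k⟩
  obtain ⟨i, hi⟩ := Finite.exists_max fun i => |v i| / x i
  set t := |v i| / x i with ht
  have hle : ∀ j, |v j| ≤ t * x j := fun j => (div_le_iff₀ (hx j)).mp (hi j)
  have hvi : |v i| = t * x i := (div_mul_cancel₀ _ (hx i).ne').symm
  have htpos : 0 < t := lt_of_lt_of_le (div_pos (abs_pos.mpr hk) (hx k)) (hi k)
  have key : μ * (t * x i) ≤ r * (t * x i) := calc
    μ * (t * x i) ≤ |μ| * |v i| := by
      rw [← hvi]; exact mul_le_mul_of_nonneg_right (le_abs_self μ) (abs_nonneg _)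
    _ = |∑ j, M i j * v j| := by
      rw [← abs_mul]; exact congrArg abs (congrFun hMv i).symm
    _ ≤ ∑ j, |M i j * v j| := Finset.abs_sum_le_sum_abs _ _
    _ ≤ ∑ j, t * (|M i j| * x j) := Finset.sum_le_sum fun j _ => by
      rw [abs_mul, mul_left_comm]
      exact mul_le_mul_of_nonneg_left (hle j) (abs_nonneg _)
    _ = t * ∑ j, |M i j| * x j := (Finset.mul_sum _ _ _).symm
    _ ≤ t * (r * x i) := mul_le_mul_of_nonneg_left (h i) htpos.le
    _ = r * (t * x i) := mul_left_comm _ _ _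
  exact le_of_mul_le_mul_right key (mul_pos htpos (hx i))

theorem mem_spectrum_of_mulVec_eq_smul {V : Type*} [Fintype V] [DecidableEq V]
    {M : Matrix V V ℝ} {v : V → ℝ} {μ : ℝ} (hv : v ≠ 0) (h : M.mulVec v = μ • v) :
    μ ∈ spectrum ℝ M := by
  rw [← Matrix.spectrum_toLin', ← Module.End.hasEigenvalue_iff_mem_spectrum]
  exact Module.End.hasEigenvalue_of_hasEigenvector
    ⟨Module.End.mem_eigenspace_iff.mpr (by simpa using h), hv⟩

/-- If `|M| |v| ≤ r |v|` and `M v = r v` for a nowhere vanishing `v`, then `r` is the largest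
eigenvalue of `M`. -/
theorem sSup_spectrum_eq {V : Type*} [Fintype V] [DecidableEq V] [Nonempty V]
    {M : Matrix V V ℝ} {v : V → ℝ} {r : ℝ} (hv : ∀ i, v i ≠ 0)
    (habs : ∀ i, ∑ j, |M i j| * |v j| ≤ r * |v i|) (h : M.mulVec v = r • v) :
    sSup (spectrum ℝ M) = r :=
  IsGreatest.csSup_eq
    ⟨mem_spectrum_of_mulVec_eq_smul (fun h0 => hv (Classical.arbitrary V) (congrFun h0 _)) h,
      fun _ hμ => le_of_mem_spectrum_of_abs_mulVec_le (fun i => abs_pos.mpr (hv i)) habs hμ⟩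

/-- The graph on `Fin 8` joining every vertex to its parent under `p`. -/
def parentGraph (p : Fin 8 → Fin 8) : SimpleGraph (Fin 8) :=
  SimpleGraph.fromRel fun i j => j = p i

instance (p : Fin 8 → Fin 8) : DecidableRel (parentGraph p).Adj := fun i j =>
  inferInstanceAs (Decidable (i ≠ j ∧ (j = p i ∨ i = p j)))

theorem parentGraph_connected {p : Fin 8 → Fin 8} (hp : ∀ i, i ≠ 0 → p i < i) :
    (parentGraph p).Connected := by
  have h0 : ∀ i, (parentGraph p).Reachable i 0 := by
    intro i
    induction i using WellFoundedLT.induction with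
    | ind i ih =>
      by_cases hi : i = 0
      · rw [hi]
      · have hadj : (parentGraph p).Adj i (p i) := ⟨(hp i hi).ne', Or.inl rfl⟩
        exact hadj.reachable.trans (ih _ (hp i hi))
  exact ⟨fun i j => (h0 i).trans (h0 j).symm⟩

theorem parentGraph_isTree {p : Fin 8 → Fin 8} (hp : ∀ i, i ≠ 0 → p i < i)
    (hcard : (parentGraph p).edgeFinset.card = 7) : (parentGraph p).IsTree := by
  rw [SimpleGraph.isTree_iff_connected_and_card]
  refine ⟨parentGraph_connected hp, ?_⟩
  rw [Nat.card_eq_fintype_card, ← SimpleGraph.edgeFinset_card, hcard]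
  simp

theorem adjMat_eq {V : Type*} [Fintype V] (G : SimpleGraph V) [DecidableRel G.Adj] (i j : V) :
    adjMat G i j = if G.Adj i j then 1 else 0 := by
  unfold adjMat
  congr

/-- The tree with one branch vertex and legs of lengths 1, 2 and 4. -/
def spiderTree : SimpleGraph (Fin 8) := parentGraph ![0, 0, 0, 0, 1, 2, 4, 6]

/-- The path on four vertices with two extra leaves at each end. -/
def doubleBroom : SimpleGraph (Fin 8) := parentGraph ![0, 0, 0, 0, 1, 4, 5, 5]

theorem adjMat_spiderTree : adjMat spiderTree =
    !![0, 1, 1, 1, 0, 0, 0, 0;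
       1, 0, 0, 0, 1, 0, 0, 0;
       1, 0, 0, 0, 0, 1, 0, 0;
       1, 0, 0, 0, 0, 0, 0, 0;
       0, 1, 0, 0, 0, 0, 1, 0;
       0, 0, 1, 0, 0, 0, 0, 0;
       0, 0, 0, 0, 1, 0, 0, 1;
       0, 0, 0, 0, 0, 0, 1, 0] := by
  ext i j
  rw [spiderTree, adjMat_eq]
  fin_cases i <;> fin_cases j <;> first | exact if_pos (by decide) | exact if_neg (by decide)

theorem adjMat_doubleBroom : adjMat doubleBroom =
    !![0, 1, 1, 1, 0, 0, 0, 0;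
       1, 0, 0, 0, 1, 0, 0, 0;
       1, 0, 0, 0, 0, 0, 0, 0;
       1, 0, 0, 0, 0, 0, 0, 0;
       0, 1, 0, 0, 0, 1, 0, 0;
       0, 0, 0, 0, 1, 0, 1, 1;
       0, 0, 0, 0, 0, 1, 0, 0;
       0, 0, 0, 0, 0, 1, 0, 0] := by
  ext i j
  rw [doubleBroom, adjMat_eq]
  fin_cases i <;> fin_cases j <;> first | exact if_pos (by decide) | exact if_neg (by decide)

theorem lapMat_spiderTree : lapMat spiderTree =
    !![3, -1, -1, -1, 0, 0, 0, 0;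
       -1, 2, 0, 0, -1, 0, 0, 0;
       -1, 0, 2, 0, 0, -1, 0, 0;
       -1, 0, 0, 1, 0, 0, 0, 0;
       0, -1, 0, 0, 2, 0, -1, 0;
       0, 0, -1, 0, 0, 1, 0, 0;
       0, 0, 0, 0, -1, 0, 2, -1;
       0, 0, 0, 0, 0, 0, -1, 1] := by
  ext i j
  fin_cases i <;> fin_cases j <;>
    simp [lapMat, degRe, adjMat_spiderTree, Fin.sum_univ_eight] <;> norm_num

theorem lapMat_doubleBroom : lapMat doubleBroom =
    !![3, -1, -1, -1, 0, 0, 0, 0;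
       -1, 2, 0, 0, -1, 0, 0, 0;
       -1, 0, 1, 0, 0, 0, 0, 0;
       -1, 0, 0, 1, 0, 0, 0, 0;
       0, -1, 0, 0, 2, -1, 0, 0;
       0, 0, 0, 0, -1, 3, -1, -1;
       0, 0, 0, 0, 0, -1, 1, 0;
       0, 0, 0, 0, 0, -1, 0, 1] := by
  ext i j
  fin_cases i <;> fin_cases j <;>
    simp [lapMat, degRe, adjMat_doubleBroom, Fin.sum_univ_eight] <;> norm_num

theorem exists_root_cubic : ∃ q : ℝ, 4.3 < q ∧ q ^ 3 - 7 * q ^ 2 + 12 * q - 2 = 0 := by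
  have hcont : ContinuousOn (fun q : ℝ => q ^ 3 - 7 * q ^ 2 + 12 * q - 2) (Set.Icc 4.3 5) := by
    fun_prop
  obtain ⟨q, hq, hq0⟩ := intermediate_value_Ioo (by norm_num) hcont
    (show (0 : ℝ) ∈ Set.Ioo _ _ by constructor <;> norm_num)
  exact ⟨q, hq.1, hq0⟩

theorem q1_spiderTree {q : ℝ} (hq : 4.3 < q) (hroot : q ^ 3 - 7 * q ^ 2 + 12 * q - 2 = 0) :
    q1 spiderTree = q := by
  have h0 : 0 < 3 * q ^ 2 - 8 * q + 1 := by nlinarith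
  have h1 : 0 < 2 * q ^ 2 - 6 * q + 1 := by nlinarith
  have h2 : 0 < (q - 1) ^ 2 := by nlinarith
  have h3 : 0 < q ^ 2 - 3 * q + 1 := by nlinarith
  have h5 : 0 < q - 1 := by linarith
  refine sSup_spectrum_eq (v := ![3 * q ^ 2 - 8 * q + 1, -(2 * q ^ 2 - 6 * q + 1), -(q - 1) ^ 2,
    -(q ^ 2 - 3 * q + 1), q ^ 2 - 3 * q + 1, q - 1, -(q - 1), 1]) ?_ ?_ ?_
  · intro i
    fin_cases i
    exacts [h0.ne', neg_ne_zero.mpr h1.ne', neg_ne_zero.mpr h2.ne', neg_ne_zero.mpr h3.ne',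
      h3.ne', h5.ne', neg_ne_zero.mpr h5.ne', one_ne_zero]
  · intro i
    rw [lapMat_spiderTree]
    fin_cases i <;> simp [Fin.sum_univ_eight, -neg_sub, -neg_add_rev, abs_of_pos h0,
      abs_of_pos h1, abs_of_pos h3, abs_of_pos h5] <;> linarith
  · rw [lapMat_spiderTree]
    ext i
    fin_cases i <;> simp [Matrix.mulVec, dotProduct, Fin.sum_univ_eight] <;> linarith

theorem q1_doubleBroom {q : ℝ} (hq : 4.3 < q) (hroot : q ^ 3 - 7 * q ^ 2 + 12 * q - 2 = 0) :
    q1 doubleBroom = q := by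
  have h0 : 0 < q - 1 := by linarith
  have h1 : 0 < q ^ 2 - 4 * q + 1 := by nlinarith
  refine sSup_spectrum_eq (v := ![q - 1, -(q ^ 2 - 4 * q + 1), -1, -1, q ^ 2 - 4 * q + 1,
    -(q - 1), 1, 1]) ?_ ?_ ?_
  · intro i
    fin_cases i
    exacts [h0.ne', neg_ne_zero.mpr h1.ne', neg_ne_zero.mpr one_ne_zero,
      neg_ne_zero.mpr one_ne_zero, h1.ne', neg_ne_zero.mpr h0.ne', one_ne_zero, one_ne_zero]
  · intro i
    rw [lapMat_doubleBroom]
    fin_cases i <;> simp [Fin.sum_univ_eight, -neg_sub, -neg_add_rev, abs_of_pos h0,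
      abs_of_pos h1] <;> linarith
  · rw [lapMat_doubleBroom]
    ext i
    fin_cases i <;> simp [Matrix.mulVec, dotProduct, Fin.sum_univ_eight] <;> linarith

theorem lam1_spiderTree_lt : lam1 spiderTree < 2 := by
  have hle : lam1 spiderTree ≤ 1.999 := by
    refine Real.sSup_le (fun μ hμ => le_of_mem_spectrum_of_abs_mulVec_le
      (x := ![189, 154, 127, 95, 117, 64, 79, 40]) ?_ ?_ hμ) (by norm_num)
    · intro i
      fin_cases i <;> simp
    · intro i
      rw [adjMat_spiderTree]
      fin_cases i <;> simp [Fin.sum_univ_eight] <;> norm_num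
  exact hle.trans_lt (by norm_num)

theorem lam1_doubleBroom : lam1 doubleBroom = 2 := by
  refine sSup_spectrum_eq (v := ![2, 2, 1, 1, 2, 2, 1, 1]) ?_ ?_ ?_
  · intro i
    fin_cases i <;> simp
  · intro i
    rw [adjMat_doubleBroom]
    fin_cases i <;> simp [Fin.sum_univ_eight] <;> norm_num
  · rw [adjMat_doubleBroom]
    ext i
    fin_cases i <;> simp [Matrix.mulVec, dotProduct, Fin.sum_univ_eight] <;> norm_num

theorem lam1_eq_of_iso {V W : Type*} [Fintype V] [DecidableEq V] [Fintype W] [DecidableEq W]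
    {G : SimpleGraph V} {H : SimpleGraph W} (e : G ≃g H) : lam1 G = lam1 H := by
  have h : Matrix.reindexAlgEquiv ℝ ℝ e.toEquiv (adjMat G) = adjMat H := by
    ext i j
    have hadj : G.Adj (e.symm i) (e.symm j) ↔ H.Adj i j := e.symm.map_adj_iff
    change adjMat G (e.symm i) (e.symm j) = adjMat H i j
    classical rw [adjMat_eq, adjMat_eq, if_congr hadj rfl rfl]
  rw [lam1, lam1, ← h, AlgEquiv.spectrum_eq]

/-- There are two non-isomorphic trees on 8 vertices with equal largest
Laplacian eigenvalue but different largest adjacency eigenvalue. -/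
theorem exists_noniso_trees_eight_vertices_laplacian_cospectral_radius_adjacency_different :
    ∃ T T' : SimpleGraph (Fin 8), T.IsTree ∧ T'.IsTree ∧ ¬ Nonempty (T ≃g T') ∧
      q1 T = q1 T' ∧ lam1 T ≠ lam1 T' := by
  obtain ⟨q, hq, hroot⟩ := exists_root_cubic
  have hne : lam1 spiderTree ≠ lam1 doubleBroom := by
    rw [lam1_doubleBroom]
    exact lam1_spiderTree_lt.ne
  exact ⟨spiderTree, doubleBroom, parentGraph_isTree (by decide) (by decide),
    parentGraph_isTree (by decide) (by decide), fun ⟨e⟩ => hne (lam1_eq_of_iso e),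
    (q1_spiderTree hq hroot).trans (q1_doubleBroom hq hroot).symm, hne⟩
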